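/- arXiv:1207.6572 — 2 statements merged into one kernel-verified Lean document; each statement's English description precedes it below -/
import Mathlib

section
/- Let Ψ = {A_1, …, A_m} be a finite set of nonnegative n×n matrices, at least one of which is nonzero, and let S = A_1 ⊕ ⋯ ⊕ A_m be their entrywise maximum. Then the max generalised spectral radius of Ψ equals the maximal cycle geometric mean of S: μ̂(Ψ) = μ(S). -/
open Filter Relation

namespace MaxAlg

/-- Max-algebraic action of a matrix on a vector: `(A ⊗ x) i = max_j A i j * x j`. -/
noncomputable def maxVec {n : ℕ} (A : Fin n → Fin n → ℝ) (x : Fin n → ℝ) : Fin n → ℝ :=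
  fun i => ⨆ j, A i j * x j

/-- Max-algebraic matrix product: `(A ⊗ B) i k = max_j A i j * B j k`. -/
noncomputable def maxMul {n : ℕ} (A B : Fin n → Fin n → ℝ) : Fin n → Fin n → ℝ :=
  fun i k => ⨆ j, A i j * B j k

/-- The weight of the cycle determined by a list `[i₁, …, i_k]`,
namely `A i₁ i₂ * ⋯ * A i_{k-1} i_k * A i_k i₁`. -/
noncomputable def cycleProd {n : ℕ} (A : Fin n → Fin n → ℝ) (l : List (Fin n)) : ℝ :=
  ((l.zip (l.rotate 1)).map fun p => A p.1 p.2).prod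

/-- The maximal cycle geometric mean of `A`: the supremum over all cycles of distinct
nodes of the k-th root of the cycle weight. -/
noncomputable def mu {n : ℕ} (A : Fin n → Fin n → ℝ) : ℝ :=
  sSup {c | ∃ l : List (Fin n), l ≠ [] ∧ l.Nodup ∧ c = cycleProd A l ^ ((l.length : ℝ)⁻¹)}

/-- `C_{A,r}`: the positive vectors with `A ⊗ x ≤ r x`. -/
def Cset {n : ℕ} (A : Fin n → Fin n → ℝ) (r : ℝ) : Set (Fin n → ℝ) :=
  {x | (∀ i, 0 < x i) ∧ ∀ i, maxVec A x i ≤ r * x i}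

/-- A critical cycle: a cycle of distinct nodes attaining `mu A`. -/
def IsCriticalCycle {n : ℕ} (A : Fin n → Fin n → ℝ) (l : List (Fin n)) : Prop :=
  l ≠ [] ∧ l.Nodup ∧ cycleProd A l ^ ((l.length : ℝ)⁻¹) = mu A

/-- `(i,j) ∈ E^C(A)`: the edge `(i,j)` lies on some critical cycle. -/
def criticalEdge {n : ℕ} (A : Fin n → Fin n → ℝ) (i j : Fin n) : Prop :=
  ∃ l : List (Fin n), IsCriticalCycle A l ∧ (i, j) ∈ l.zip (l.rotate 1)

/-- `i ∈ N^C(A)`: the node `i` lies on some critical cycle. -/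
def criticalNode {n : ℕ} (A : Fin n → Fin n → ℝ) (i : Fin n) : Prop :=
  ∃ l : List (Fin n), IsCriticalCycle A l ∧ i ∈ l

/-- Irreducibility: the digraph of `A` (edge `(i,j)` iff `A i j > 0`) is strongly connected. -/
def Irred {n : ℕ} (A : Fin n → Fin n → ℝ) : Prop :=
  ∀ i j, Relation.ReflTransGen (fun a b => 0 < A a b) i j

/-- Max-algebraic product of a word of matrices from the family `A`. -/
noncomputable def wordProd {n m : ℕ} (A : Fin m → Fin n → Fin n → ℝ) :
    List (Fin m) → (Fin n → Fin n → ℝ)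
  | [] => fun i j => if i = j then 1 else 0
  | [j] => A j
  | j :: k :: w => maxMul (A j) (wordProd A (k :: w))

/-- The max version of the generalised spectral radius
`μ̂(Ψ) = limsup_{p→∞} (max_{ψ ∈ Ψ^p_⊗} μ(ψ))^{1/p}`. -/
noncomputable def genSpecRad {n m : ℕ} (A : Fin m → Fin n → Fin n → ℝ) : ℝ :=
  Filter.limsup
    (fun p : ℕ =>
      (sSup {c | ∃ w : List (Fin m), w.length = p ∧ c = mu (wordProd A w)}) ^ ((p : ℝ)⁻¹))
    Filter.atTop

/-- `S = A₁ ⊕ ⋯ ⊕ A_m`: the entrywise maximum of the family. -/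
noncomputable def Smat {n m : ℕ} (A : Fin m → Fin n → Fin n → ℝ) : Fin n → Fin n → ℝ :=
  fun i j => ⨆ k, A k i j

/-- The relative error function `e_A(x) = max_{i,j} A i j * x j / x i`. -/
noncomputable def errF {n : ℕ} (A : Fin n → Fin n → ℝ) (x : Fin n → ℝ) : ℝ :=
  ⨆ i, ⨆ j, A i j * x j / x i

/-- A symmetrically reciprocal (SR) matrix: positive, with unit diagonal and
`A i j * A j i = 1` for `i ≠ j`. -/
def IsSR {n : ℕ} (A : Fin n → Fin n → ℝ) : Prop :=
  (∀ i j, 0 < A i j) ∧ (∀ i, A i i = 1) ∧ ∀ i j, i ≠ j → A i j * A j i = 1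

/-- Max-algebraic matrix powers. -/
noncomputable def maxPow {n : ℕ} (B : Fin n → Fin n → ℝ) : ℕ → (Fin n → Fin n → ℝ)
  | 0 => fun i j => if i = j then 1 else 0
  | p + 1 => maxMul B (maxPow B p)

/-- The Kleene star `B* = I ⊕ B ⊕ B⊗² ⊕ ⋯ ⊕ B⊗^{n-1}`. -/
noncomputable def kleeneStar {n : ℕ} (B : Fin n → Fin n → ℝ) : Fin n → Fin n → ℝ :=
  fun i j => ⨆ p : Fin n, maxPow B p i j

variable {n m : ℕ}

theorem mul_le_maxMul (A B : Fin n → Fin n → ℝ) (i j k : Fin n) :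
    A i j * B j k ≤ maxMul A B i k :=
  le_ciSup (f := fun j => A i j * B j k) (Set.finite_range _).bddAbove j

theorem exists_maxMul_eq (A B : Fin n → Fin n → ℝ) (i k : Fin n) :
    ∃ j, A i j * B j k = maxMul A B i k :=
  have : Nonempty (Fin n) := ⟨i⟩
  exists_eq_ciSup_of_finite (f := fun j => A i j * B j k)

theorem maxMul_nonneg {A B : Fin n → Fin n → ℝ} (hA : ∀ i j, 0 ≤ A i j)
    (hB : ∀ i j, 0 ≤ B i j) (i k : Fin n) : 0 ≤ maxMul A B i k :=
  Real.iSup_nonneg fun j => mul_nonneg (hA i j) (hB j k)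

theorem maxPow_nonneg {S : Fin n → Fin n → ℝ} (hS : ∀ i j, 0 ≤ S i j) (p : ℕ) :
    ∀ i j, 0 ≤ maxPow S p i j := by
  induction p with
  | zero => intro i j; simp only [maxPow]; split_ifs <;> norm_num
  | succ p ih => exact maxMul_nonneg hS ih

theorem maxPow_mul_le_maxPow_add {S : Fin n → Fin n → ℝ} (hS : ∀ i j, 0 ≤ S i j) (p q : ℕ)
    (i j k : Fin n) : maxPow S p i j * maxPow S q j k ≤ maxPow S (p + q) i k := by
  induction p generalizing i with
  | zero =>
    by_cases h : i = j
    · subst h; simp [maxPow]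
    · simpa [maxPow, h] using maxPow_nonneg hS q i k
  | succ p ih =>
    obtain ⟨a, ha⟩ := exists_maxMul_eq S (maxPow S p) i j
    rw [Nat.succ_add]
    calc maxMul S (maxPow S p) i j * maxPow S q j k
        = S i a * (maxPow S p a j * maxPow S q j k) := by rw [← ha, mul_assoc]
      _ ≤ S i a * maxPow S (p + q) a k := mul_le_mul_of_nonneg_left (ih a) (hS i a)
      _ ≤ _ := mul_le_maxMul S (maxPow S (p + q)) i a k

theorem prod_maxPow_le {S : Fin n → Fin n → ℝ} (hS : ∀ i j, 0 ≤ S i j) (p : ℕ)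
    (f : ℕ → Fin n) (k : ℕ) :
    ∏ t ∈ Finset.range k, maxPow S p (f t) (f (t + 1)) ≤ maxPow S (p * k) (f 0) (f k) := by
  induction k with
  | zero => simp [maxPow]
  | succ k ih =>
    rw [Finset.prod_range_succ, Nat.mul_succ]
    exact (mul_le_mul_of_nonneg_right ih (maxPow_nonneg hS _ _ _)).trans
      (maxPow_mul_le_maxPow_add hS _ _ _ _ _)

/-- A nonzero entry of a max-algebraic power is the weight of a walk. -/
theorem exists_walk_of_maxPow {S : Fin n → Fin n → ℝ} (p : ℕ) (i j : Fin n)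
    (h : maxPow S p i j ≠ 0) :
    ∃ f : ℕ → Fin n, f 0 = i ∧ f p = j ∧
      maxPow S p i j = ∏ t ∈ Finset.range p, S (f t) (f (t + 1)) := by
  induction p generalizing i with
  | zero =>
    have hij : i = j := by by_contra hij; exact h (by simp [maxPow, hij])
    exact ⟨fun _ => i, rfl, hij, by simp [maxPow, hij]⟩
  | succ p ih =>
    obtain ⟨a, ha⟩ := exists_maxMul_eq S (maxPow S p) i j
    change maxMul S (maxPow S p) i j ≠ 0 at h
    rw [← ha] at h
    obtain ⟨f, hf0, hfp, hf⟩ := ih a (right_ne_zero_of_mul h)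
    refine ⟨fun t => Nat.casesOn t i f, rfl, hfp, ?_⟩
    change maxMul S (maxPow S p) i j = _
    rw [← ha, Finset.prod_range_succ', hf, mul_comm]
    simp [hf0]

theorem cycleProd_map_range (A : Fin n → Fin n → ℝ) (f : ℕ → Fin n) {k : ℕ}
    (hf : f k = f 0) :
    cycleProd A ((List.range k).map f) = ∏ t ∈ Finset.range k, A (f t) (f (t + 1)) := by
  have : (((List.range k).map f).zip (((List.range k).map f).rotate 1)).map
      (fun p => A p.1 p.2) = (List.range k).map fun t => A (f t) (f (t + 1)) := by
    refine List.ext_getElem (by simp) fun t h₁ h₂ => ?_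
    have ht : t < k := by simpa using h₂
    simp only [List.getElem_map, List.getElem_zip, List.getElem_range, List.getElem_rotate,
      List.length_map, List.length_range]
    rcases Nat.lt_or_ge (t + 1) k with h | h
    · rw [Nat.mod_eq_of_lt h]
    · have : t + 1 = k := by omega
      rw [this, Nat.mod_self, hf]
  rw [cycleProd, this, Finset.prod_range, ← List.prod_ofFn]
  congr 1
  exact List.ext_getElem (by simp) fun t h₁ h₂ => by simp

theorem exists_periodic_eq_map_range (l : List (Fin n)) (hl : l ≠ []) :
    ∃ f : ℕ → Fin n, (∀ t, f (t + l.length) = f t) ∧ l = (List.range l.length).map f := by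
  have hpos : 0 < l.length := List.length_pos_iff.2 hl
  refine ⟨fun t => l[t % l.length]'(Nat.mod_lt _ hpos), fun t => by simp, ?_⟩
  refine List.ext_getElem (by simp) fun t h₁ h₂ => ?_
  simp [Nat.mod_eq_of_lt h₁]

theorem finite_cycleMeans (A : Fin n → Fin n → ℝ) :
    {c | ∃ l : List (Fin n), l ≠ [] ∧ l.Nodup ∧
      c = cycleProd A l ^ ((l.length : ℝ)⁻¹)}.Finite := by
  refine (Set.finite_range fun l : {l : List (Fin n) // l.Nodup} =>
    cycleProd A l.1 ^ ((l.1.length : ℝ)⁻¹)).subset ?_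
  rintro c ⟨l, -, hl, rfl⟩
  exact ⟨⟨l, hl⟩, rfl⟩

theorem le_mu (A : Fin n → Fin n → ℝ) {l : List (Fin n)} (hl : l ≠ []) (hd : l.Nodup) :
    cycleProd A l ^ ((l.length : ℝ)⁻¹) ≤ mu A :=
  le_csSup (finite_cycleMeans A).bddAbove ⟨l, hl, hd, rfl⟩

theorem cycleProd_nonneg {A : Fin n → Fin n → ℝ} (hA : ∀ i j, 0 ≤ A i j)
    (l : List (Fin n)) : 0 ≤ cycleProd A l :=
  List.prod_nonneg fun x hx => by
    obtain ⟨p, -, rfl⟩ := List.mem_map.1 hx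
    exact hA _ _

theorem mu_nonneg {A : Fin n → Fin n → ℝ} (hA : ∀ i j, 0 ≤ A i j) : 0 ≤ mu A :=
  Real.sSup_nonneg fun _ ⟨l, _, _, hc⟩ => hc ▸ Real.rpow_nonneg (cycleProd_nonneg hA l) _

theorem diag_le_mu (A : Fin n → Fin n → ℝ) (i : Fin n) : A i i ≤ mu A := by
  simpa [cycleProd] using le_mu A (List.cons_ne_nil i []) (List.nodup_singleton i)

theorem exists_isCriticalCycle [NeZero n] (A : Fin n → Fin n → ℝ) :
    ∃ l, IsCriticalCycle A l := by
  have hne : {c | ∃ l : List (Fin n), l ≠ [] ∧ l.Nodup ∧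
      c = cycleProd A l ^ ((l.length : ℝ)⁻¹)}.Nonempty :=
    ⟨_, [0], List.cons_ne_nil _ _, List.nodup_singleton _, rfl⟩
  obtain ⟨l, hl, hd, h⟩ := hne.csSup_mem (finite_cycleMeans A)
  exact ⟨l, hl, hd, h.symm⟩

theorem rpow_inv_natCast_le {x y : ℝ} {k : ℕ} (hx : 0 ≤ x) (hy : 0 ≤ y) (hk : k ≠ 0)
    (h : x ≤ y ^ k) : x ^ ((k : ℝ)⁻¹) ≤ y :=
  (Real.rpow_le_rpow hx h (by positivity)).trans_eq (Real.pow_rpow_inv_natCast hy hk)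

/-- The weight of a closed walk of length `L` is at most the `L`-th power of the maximal cycle
geometric mean. -/
theorem prod_closed_walk_le {S : Fin n → Fin n → ℝ} (hS : ∀ i j, 0 ≤ S i j) (L : ℕ)
    (f : ℕ → Fin n) (hf : f L = f 0) :
    ∏ t ∈ Finset.range L, S (f t) (f (t + 1)) ≤ mu S ^ L := by
  induction L using Nat.strong_induction_on generalizing f with
  | _ L ih =>
  rcases Nat.eq_zero_or_pos L with rfl | hL
  · simp
  by_cases hinj : Set.InjOn f (Set.Iio L)
  · have hd : ((List.range L).map f).Nodup :=
      List.Nodup.map_on (fun x hx y hy h => hinj (by simpa using hx) (by simpa using hy) h)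
        List.nodup_range
    have h := le_mu S (by simpa using hL.ne') hd
    rw [List.length_map, List.length_range] at h
    have h0 := cycleProd_nonneg hS ((List.range L).map f)
    rw [← cycleProd_map_range S f hf, ← Real.rpow_inv_natCast_pow h0 hL.ne']
    exact pow_le_pow_left₀ (Real.rpow_nonneg h0 _) h L
  · obtain ⟨i, j, hij, hjL, hfij⟩ : ∃ i j, i < j ∧ j < L ∧ f i = f j := by
      simp only [Set.InjOn, Set.mem_Iio] at hinj
      push Not at hinj
      obtain ⟨a, ha, b, hb, hab, hne⟩ := hinj
      rcases lt_or_gt_of_ne hne with h | h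
      · exact ⟨a, b, h, hb, hab⟩
      · exact ⟨b, a, h, ha, hab.symm⟩
    obtain ⟨d, rfl⟩ := Nat.exists_eq_add_of_lt hij
    obtain ⟨e, rfl⟩ := Nat.exists_eq_add_of_lt hjL
    have hloop := ih (d + 1) (by omega) (fun t => f (i + t))
      (by simpa [add_assoc] using hfij.symm)
    have hrest := ih (i + (e + 1)) (by omega)
      (fun t => if t ≤ i then f t else f (t + (d + 1)))
      (by rw [if_neg (by omega), if_pos (Nat.zero_le _), ← hf]; congr 1; omega)
    have hsplit : ∏ t ∈ Finset.range (i + (e + 1)),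
        S (if t ≤ i then f t else f (t + (d + 1)))
          (if t + 1 ≤ i then f (t + 1) else f (t + 1 + (d + 1))) =
        (∏ t ∈ Finset.range i, S (f t) (f (t + 1))) *
          ∏ t ∈ Finset.range (e + 1), S (f (i + (d + 1) + t)) (f (i + (d + 1) + t + 1)) := by
      rw [Finset.prod_range_add]
      congr 1
      · refine Finset.prod_congr rfl fun t ht => ?_
        have := Finset.mem_range.1 ht
        rw [if_pos (by omega), if_pos (by omega)]
      · refine Finset.prod_congr rfl fun t _ => ?_
        have h₁ : (if i + t ≤ i then f (i + t) else f (i + t + (d + 1))) =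
            f (i + (d + 1) + t) := by
          split_ifs with h
          · obtain rfl : t = 0 := by omega
            exact hfij
          · congr 1; omega
        rw [h₁, if_neg (by omega)]
        congr 2; omega
    have hL' : i + d + 1 + e + 1 = i + (d + 1) + (e + 1) := by omega
    rw [hsplit] at hrest
    rw [hL', Finset.prod_range_add, Finset.prod_range_add]
    calc _ = (∏ t ∈ Finset.range (d + 1), S (f (i + t)) (f (i + (t + 1)))) *
          ((∏ t ∈ Finset.range i, S (f t) (f (t + 1))) *
          ∏ t ∈ Finset.range (e + 1), S (f (i + (d + 1) + t)) (f (i + (d + 1) + t + 1))) := by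
            simp only [← add_assoc]; ring
      _ ≤ mu S ^ (d + 1) * mu S ^ (i + (e + 1)) :=
          mul_le_mul hloop hrest
            (mul_nonneg (Finset.prod_nonneg fun _ _ => hS _ _)
              (Finset.prod_nonneg fun _ _ => hS _ _)) (pow_nonneg (mu_nonneg hS) _)
      _ = _ := by ring

theorem maxPow_diag_le {S : Fin n → Fin n → ℝ} (hS : ∀ i j, 0 ≤ S i j) (L : ℕ) (i : Fin n) :
    maxPow S L i i ≤ mu S ^ L := by
  by_cases h : maxPow S L i i = 0
  · rw [h]; exact pow_nonneg (mu_nonneg hS) _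
  · obtain ⟨f, hf0, hfL, hf⟩ := exists_walk_of_maxPow L i i h
    rw [hf]
    exact prod_closed_walk_le hS L f (hfL.trans hf0.symm)

theorem le_Smat (A : Fin m → Fin n → Fin n → ℝ) (k : Fin m) (i j : Fin n) :
    A k i j ≤ Smat A i j :=
  le_ciSup (f := fun k => A k i j) (Set.finite_range _).bddAbove k

theorem Smat_nonneg {A : Fin m → Fin n → Fin n → ℝ} (hA : ∀ k i j, 0 ≤ A k i j)
    (i j : Fin n) : 0 ≤ Smat A i j :=
  Real.iSup_nonneg fun k => hA k i j

theorem maxMul_one (A : Fin n → Fin n → ℝ) (hA : ∀ i j, 0 ≤ A i j) :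
    maxMul A (fun i j => if i = j then 1 else 0) = A := by
  ext i k
  have : Nonempty (Fin n) := ⟨i⟩
  refine le_antisymm (ciSup_le fun j => ?_) ?_
  · by_cases h : j = k
    · simp [h]
    · simpa [h] using hA i k
  · simpa using mul_le_maxMul A (fun i j => if i = j then 1 else 0) i k k

theorem wordProd_cons {A : Fin m → Fin n → Fin n → ℝ} (hA : ∀ k i j, 0 ≤ A k i j)
    (k : Fin m) (w : List (Fin m)) : wordProd A (k :: w) = maxMul (A k) (wordProd A w) := by
  cases w with
  | nil => exact (maxMul_one (A k) (hA k)).symm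
  | cons => rfl

theorem wordProd_nonneg {A : Fin m → Fin n → Fin n → ℝ} (hA : ∀ k i j, 0 ≤ A k i j)
    (w : List (Fin m)) : ∀ i j, 0 ≤ wordProd A w i j := by
  induction w with
  | nil => intro i j; simp only [wordProd]; split_ifs <;> norm_num
  | cons k w ih => rw [wordProd_cons hA]; exact maxMul_nonneg (hA k) ih

theorem wordProd_le_maxPow {A : Fin m → Fin n → Fin n → ℝ} (hA : ∀ k i j, 0 ≤ A k i j)
    (w : List (Fin m)) (i j : Fin n) : wordProd A w i j ≤ maxPow (Smat A) w.length i j := by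
  induction w generalizing i with
  | nil => exact le_rfl
  | cons k w ih =>
    rw [wordProd_cons hA]
    obtain ⟨a, ha⟩ := exists_maxMul_eq (A k) (wordProd A w) i j
    rw [← ha]
    exact (mul_le_mul (le_Smat A k i a) (ih a) (wordProd_nonneg hA w a j)
      (Smat_nonneg hA i a)).trans (mul_le_maxMul _ (maxPow (Smat A) w.length) i a j)

theorem mu_wordProd_le {A : Fin m → Fin n → Fin n → ℝ} (hA : ∀ k i j, 0 ≤ A k i j)
    (w : List (Fin m)) : mu (wordProd A w) ≤ mu (Smat A) ^ w.length := by
  have hS := Smat_nonneg hA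
  have hμ := pow_nonneg (mu_nonneg hS) w.length
  refine Real.sSup_le ?_ hμ
  rintro c ⟨l, hl, -, rfl⟩
  refine rpow_inv_natCast_le (cycleProd_nonneg (wordProd_nonneg hA w) l) hμ
    (List.length_pos_iff.2 hl).ne' ?_
  obtain ⟨f, hper, hlf⟩ := exists_periodic_eq_map_range l hl
  have hf : f l.length = f 0 := by simpa using hper 0
  calc cycleProd (wordProd A w) l
      = ∏ t ∈ Finset.range l.length, wordProd A w (f t) (f (t + 1)) := by
        conv_lhs => rw [hlf]
        exact cycleProd_map_range _ f hf
    _ ≤ ∏ t ∈ Finset.range l.length, maxPow (Smat A) w.length (f t) (f (t + 1)) :=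
        Finset.prod_le_prod (fun _ _ => wordProd_nonneg hA w _ _)
          fun _ _ => wordProd_le_maxPow hA w _ _
    _ ≤ maxPow (Smat A) (w.length * l.length) (f 0) (f l.length) := prod_maxPow_le hS _ f _
    _ ≤ mu (Smat A) ^ (w.length * l.length) := by rw [hf]; exact maxPow_diag_le hS _ _
    _ = _ := pow_mul _ _ _

/-- Every walk in the digraph of the entrywise maximum is followed by some word. -/
theorem exists_word_prod_le (hm : 0 < m) {A : Fin m → Fin n → Fin n → ℝ}
    (hA : ∀ k i j, 0 ≤ A k i j) (L : ℕ) (f : ℕ → Fin n) :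
    ∃ w : List (Fin m), w.length = L ∧
      ∏ t ∈ Finset.range L, Smat A (f t) (f (t + 1)) ≤ wordProd A w (f 0) (f L) := by
  induction L generalizing f with
  | zero => exact ⟨[], rfl, by simp [wordProd]⟩
  | succ L ih =>
    have : Nonempty (Fin m) := ⟨⟨0, hm⟩⟩
    obtain ⟨w, hw, h⟩ := ih fun t => f (t + 1)
    obtain ⟨k, hk⟩ := exists_eq_ciSup_of_finite (f := fun k => A k (f 0) (f 1))
    refine ⟨k :: w, by simp [hw], ?_⟩
    rw [wordProd_cons hA, Finset.prod_range_succ', mul_comm]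
    refine le_trans ?_ (mul_le_maxMul (A k) (wordProd A w) (f 0) (f 1) (f (L + 1)))
    exact mul_le_mul hk.ge h (Finset.prod_nonneg fun _ _ => Smat_nonneg hA _ _) (hA _ _ _)

theorem prod_range_mul_of_periodic {g : ℕ → ℝ} {k : ℕ} (hg : ∀ t, g (t + k) = g t) (q : ℕ) :
    ∏ t ∈ Finset.range (k * q), g t = (∏ t ∈ Finset.range k, g t) ^ q := by
  induction q with
  | zero => simp
  | succ q ih =>
    rw [Nat.mul_succ, Finset.prod_range_add, ih, pow_succ]
    congr 1
    refine Finset.prod_congr rfl fun t _ => ?_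
    have : Function.Periodic g k := hg
    rw [add_comm, mul_comm]
    exact this.nat_mul q t

/-- the max generalised spectral radius of a finite family of
nonnegative matrices (not all zero) equals the maximal cycle geometric mean of
their entrywise maximum `S`. -/
theorem stmt2 {n m : ℕ} (hm : 0 < m) (A : Fin m → Fin n → Fin n → ℝ)
    (hA : ∀ k i j, 0 ≤ A k i j) (h0 : ∃ k, A k ≠ 0) :
    genSpecRad A = mu (Smat A) := by
  have hS := Smat_nonneg hA
  have hμ := mu_nonneg hS
  have : NeZero n := ⟨by
    rintro rfl
    obtain ⟨k, hk⟩ := h0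
    exact hk (Subsingleton.elim _ _)⟩
  have hbdd : ∀ p, mu (Smat A) ^ p ∈
      upperBounds {c | ∃ w : List (Fin m), w.length = p ∧ c = mu (wordProd A w)} := by
    rintro p c ⟨w, rfl, rfl⟩
    exact mu_wordProd_le hA w
  have hnonneg : ∀ p,
      0 ≤ sSup {c | ∃ w : List (Fin m), w.length = p ∧ c = mu (wordProd A w)} := fun p =>
    Real.sSup_nonneg fun _ ⟨w, _, hc⟩ => hc ▸ mu_nonneg (wordProd_nonneg hA w)
  have hle : ∀ᶠ p : ℕ in atTop,
      (sSup {c | ∃ w : List (Fin m), w.length = p ∧ c = mu (wordProd A w)}) ^ ((p : ℝ)⁻¹) ≤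
        mu (Smat A) := by
    filter_upwards [eventually_gt_atTop 0] with p hp
    exact rpow_inv_natCast_le (hnonneg p) hμ hp.ne'
      (Real.sSup_le (fun c hc => hbdd p hc) (pow_nonneg hμ p))
  have hge : ∃ᶠ p : ℕ in atTop, mu (Smat A) ≤
      (sSup {c | ∃ w : List (Fin m), w.length = p ∧ c = mu (wordProd A w)}) ^
        ((p : ℝ)⁻¹) := by
    obtain ⟨l, hl, -, hcrit⟩ := exists_isCriticalCycle (Smat A)
    have hpos : 0 < l.length := List.length_pos_iff.2 hl
    obtain ⟨f, hper, hlf⟩ := exists_periodic_eq_map_range l hl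
    have hf : f l.length = f 0 := by simpa using hper 0
    have hprod : ∏ t ∈ Finset.range l.length, Smat A (f t) (f (t + 1)) =
        mu (Smat A) ^ l.length := by
      rw [← cycleProd_map_range _ f hf, ← hlf, ← hcrit,
        Real.rpow_inv_natCast_pow (cycleProd_nonneg hS l) hpos.ne']
    refine frequently_atTop.2 fun N => ⟨l.length * (N + 1), ?_, ?_⟩
    · nlinarith
    have hfp : f (l.length * (N + 1)) = f 0 := by
      have : Function.Periodic f l.length := hper
      rw [mul_comm]
      simpa using this.nat_mul (N + 1) 0
    obtain ⟨w, hw, hwf⟩ := exists_word_prod_le hm hA (l.length * (N + 1)) f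
    rw [prod_range_mul_of_periodic (g := fun t => Smat A (f t) (f (t + 1)))
      (fun t => by rw [hper, Nat.add_right_comm, hper]), hprod, ← pow_mul, hfp] at hwf
    have hp : l.length * (N + 1) ≠ 0 := (Nat.mul_pos hpos N.succ_pos).ne'
    rw [← Real.pow_rpow_inv_natCast hμ hp]
    exact Real.rpow_le_rpow (pow_nonneg hμ _)
      (hwf.trans ((diag_le_mu _ _).trans (le_csSup ⟨_, hbdd _⟩ ⟨w, hw, rfl⟩)))
      (by positivity)
  have hbelow : ∀ p : ℕ, 0 ≤
      (sSup {c | ∃ w : List (Fin m), w.length = p ∧ c = mu (wordProd A w)}) ^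
        ((p : ℝ)⁻¹) := fun p => Real.rpow_nonneg (hnonneg p) _
  exact le_antisymm
    (limsup_le_of_le (isCoboundedUnder_le_of_le atTop (x := 0) hbelow) hle)
    (le_limsup_of_frequently_le hge ⟨_, eventually_map.2 hle⟩)

end MaxAlg
end

section
/- Let Ψ = {A_1, …, A_m} be a finite set of nonnegative n×n matrices, each of which is irreducible, and let r ≥ 0. Then the set D_{Ψ,r} = {x ∈ C_{Ψ,r} : x_1 = 1} is a compact subset of ℝ^n. -/
open Filter Relation

namespace MaxAlg

/-- `A ⊗ x ≤ r x` may be checked entrywise. -/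
theorem mem_Cset_iff {n : ℕ} [NeZero n] {A : Fin n → Fin n → ℝ} {r : ℝ} {x : Fin n → ℝ} :
    x ∈ Cset A r ↔ (∀ i, 0 < x i) ∧ ∀ i j, A i j * x j ≤ r * x i :=
  and_congr_right fun _ => forall_congr' fun _ => ciSup_le_iff (Set.finite_range _).bddAbove

/-- Along a path from `i` to `j` in the digraph of `A`, the coordinates of every solution of
`A ⊗ x ≤ r x` satisfy `x j ≤ c * x i` for a constant `c` independent of `x`. -/
theorem exists_le_mul_of_path {ι : Type*} {A : ι → ι → ℝ} {r : ℝ} (hr : 0 ≤ r) {i j : ι}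
    (h : ReflTransGen (fun a b => 0 < A a b) i j) :
    ∃ c, ∀ x : ι → ℝ, (∀ a b, A a b * x b ≤ r * x a) → x j ≤ c * x i := by
  induction h with
  | refl => exact ⟨1, fun x _ => by simp⟩
  | @tail a b _ hab ih =>
    obtain ⟨c, hc⟩ := ih
    refine ⟨r * c / A a b, fun x hx => ?_⟩
    rw [div_mul_eq_mul_div, le_div_iff₀ hab, mul_comm, mul_assoc]
    exact (hx a b).trans (mul_le_mul_of_nonneg_left (hc x hx) hr)

/-- if every matrix in the family is irreducible then
`D_{Ψ,r}` is a compact subset of `ℝ^n`. -/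
theorem stmt6 {n m : ℕ} (hm : 0 < m) (A : Fin m → Fin (n + 1) → Fin (n + 1) → ℝ)
    (hA : ∀ k i j, 0 ≤ A k i j) (hirr : ∀ k, Irred (A k)) (r : ℝ) (hr : 0 ≤ r) :
    IsCompact {x ∈ ⋂ k, Cset (A k) r | x 0 = 1} := by
  let k₀ : Fin m := ⟨0, hm⟩
  have hD : {x ∈ ⋂ k, Cset (A k) r | x 0 = 1} =
      {x | (∀ i, 0 ≤ x i) ∧ (∀ k i j, A k i j * x j ≤ r * x i) ∧ x 0 = 1} := by
    ext x
    simp only [Set.mem_ofPred_eq, Set.mem_iInter, mem_Cset_iff]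
    constructor
    · rintro ⟨h, h0⟩
      exact ⟨fun i => ((h k₀).1 i).le, fun k => (h k).2, h0⟩
    · rintro ⟨hpos, h, h0⟩
      refine ⟨fun k => ⟨fun i => (hpos i).lt_of_ne' fun hi => ?_, h k⟩, h0⟩
      obtain ⟨c, hc⟩ := exists_le_mul_of_path hr (hirr k i 0)
      have := hc x (h k)
      rw [h0, hi, mul_zero] at this
      exact absurd this (by norm_num)
  rw [hD]
  choose c hc using fun j => exists_le_mul_of_path hr (hirr k₀ 0 j)
  refine (isCompact_Icc (a := (0 : Fin (n + 1) → ℝ)) (b := c)).of_isClosed_subset ?_ ?_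
  · simp only [Set.ofPred_and, Set.ofPred_forall]
    refine .inter (isClosed_iInter fun i => isClosed_le (by fun_prop) (by fun_prop)) (.inter ?_ ?_)
    · exact isClosed_iInter fun k => isClosed_iInter fun i => isClosed_iInter fun j =>
        isClosed_le (by fun_prop) (by fun_prop)
    · exact isClosed_eq (by fun_prop) (by fun_prop)
  · rintro x ⟨hpos, h, h0⟩
    exact ⟨hpos, fun j => by simpa [h0] using hc j x (h k₀)⟩

end MaxAlg
end
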